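/- Let n ≥ 2 and let 𝓕 ⊆ M_n be a non-empty set of matrices. Then 𝓕 consists of mutually commuting normal matrices if and only if there is a positive integer k with n/2 − 1 ≤ k ≤ n/2 + 1 such that W_k(X, Y) is polyhedral for every pair X, Y ∈ 𝓕. -/

import Mathlib

open Matrix

/-- The joint `C`-numerical range of a tuple of matrices
`W_C(A_1, …, A_m) = {(tr(C U*A₁U), …, tr(C U*AₘU)) : U unitary} ⊆ ℂ^m`. -/
noncomputable def jointCNumRange {n m : ℕ} (C : Matrix (Fin n) (Fin n) ℂ)
    (A : Fin m → Matrix (Fin n) (Fin n) ℂ) : Set (Fin m → ℂ) :=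
  { p | ∃ U ∈ Matrix.unitaryGroup (Fin n) ℂ, ∀ j, p j = (C * (star U * A j * U)).trace }

/-- The joint `k`-numerical range: the `C`-numerical range with
`C = diag(1, …, 1, 0, …, 0)` having exactly `k` ones. -/
noncomputable def jointKNumRange {n m : ℕ} (k : ℕ)
    (A : Fin m → Matrix (Fin n) (Fin n) ℂ) : Set (Fin m → ℂ) :=
  jointCNumRange (Matrix.diagonal fun i : Fin n => if (i : ℕ) < k then (1 : ℂ) else 0) A

/-- A subset of a real vector space is polyhedral if it is the convex hull of a finite set. -/
def IsPolyhedral {E : Type*} [AddCommGroup E] [Module ℝ E] (S : Set E) : Prop :=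
  ∃ F : Set E, F.Finite ∧ S = convexHull ℝ F

section

open scoped ComplexOrder

variable {n : ℕ}

/-- Hermitian idempotents of trace `k`, i.e. orthogonal projections of rank `k`. -/
structure IsRankProj (k : ℕ) (P : Matrix (Fin n) (Fin n) ℂ) : Prop where
  isHermitian : P.IsHermitian
  mul_self : P * P = P
  trace_eq : P.trace = k

/-- `P` maximizes `Q ↦ Re tr(QA)` among the rank-`k` projections. -/
def IsMaxProj (k : ℕ) (P A : Matrix (Fin n) (Fin n) ℂ) : Prop :=
  IsRankProj k P ∧ ∀ Q, IsRankProj k Q → (Q * A).trace.re ≤ (P * A).trace.re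

namespace IsRankProj

lemma one_sub {k : ℕ} (hk : k ≤ n) {P : Matrix (Fin n) (Fin n) ℂ} (hP : IsRankProj k P) :
    IsRankProj (n - k) (1 - P) where
  isHermitian := isHermitian_one.sub hP.isHermitian
  mul_self := by
    have := hP.mul_self
    noncomm_ring
    rw [this]; abel
  trace_eq := by simp [hP.trace_eq, Nat.cast_sub hk]

lemma conj {k : ℕ} {P U : Matrix (Fin n) (Fin n) ℂ} (hP : IsRankProj k P)
    (hU : U ∈ unitaryGroup (Fin n) ℂ) : IsRankProj k (U * P * star U) where
  isHermitian := isHermitian_mul_mul_conjTranspose U hP.isHermitian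
  mul_self := by
    have h : star U * U = 1 := mem_unitaryGroup_iff'.1 hU
    calc U * P * star U * (U * P * star U) = U * P * (star U * U) * P * star U := by
          simp only [mul_assoc]
      _ = U * (P * P) * star U := by rw [h]; simp only [mul_assoc, one_mul]
      _ = U * P * star U := by rw [hP.mul_self]
  trace_eq := by
    rw [trace_mul_comm, ← mul_assoc, mem_unitaryGroup_iff'.1 hU, one_mul, hP.trace_eq]

lemma diagonal_indicator (s : Finset (Fin n)) :
    IsRankProj s.card (diagonal fun i => if i ∈ s then (1 : ℂ) else 0) where
  isHermitian := by
    rw [isHermitian_diagonal_iff]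
    intro i
    split_ifs <;> simp [IsSelfAdjoint]
  mul_self := by
    rw [diagonal_mul_diagonal]
    congr 1; ext i; split_ifs <;> simp
  trace_eq := by simp [trace_diagonal]

lemma eigenvalues_eq {k : ℕ} {P : Matrix (Fin n) (Fin n) ℂ} (hP : IsRankProj k P) (i : Fin n) :
    hP.isHermitian.eigenvalues i = 0 ∨ hP.isHermitian.eigenvalues i = 1 := by
  have h := hP.isHermitian.mulVec_eigenvectorBasis i
  set v := (hP.isHermitian.eigenvectorBasis i).ofLp with hv
  set c := hP.isHermitian.eigenvalues i
  have hv0 : v ≠ 0 := by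
    have := hP.isHermitian.eigenvectorBasis.toBasis.ne_zero i
    simpa [hv] using this
  have h2 : P *ᵥ (P *ᵥ v) = P *ᵥ v := by rw [mulVec_mulVec, hP.mul_self]
  rw [h, mulVec_smul, h, smul_smul, ← sub_eq_zero, ← sub_smul] at h2
  rcases smul_eq_zero.1 h2 with h3 | h3
  · have : c * (c - 1) = 0 := by linarith
    rcases mul_eq_zero.1 this with h4 | h4
    · exact Or.inl h4
    · right; linarith
  · exact absurd h3 hv0

lemma exists_unitary {k : ℕ} {P : Matrix (Fin n) (Fin n) ℂ} (hP : IsRankProj k P) :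
    ∃ U ∈ unitaryGroup (Fin n) ℂ,
      P = U * (diagonal fun i : Fin n => if (i : ℕ) < k then (1 : ℂ) else 0) * star U := by
  set l := hP.isHermitian.eigenvalues with hl
  set V : Matrix (Fin n) (Fin n) ℂ := ↑hP.isHermitian.eigenvectorUnitary with hV
  have hVm : V ∈ unitaryGroup (Fin n) ℂ := hP.isHermitian.eigenvectorUnitary.2
  have hsp : P = V * diagonal (fun i => (l i : ℂ)) * star V := by
    have := hP.isHermitian.spectral_theorem
    simpa [Unitary.conjStarAlgAut_apply, Function.comp_def] using this
  have hl01 : ∀ i, (l i : ℂ) = if l i = 1 then 1 else 0 := by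
    intro i
    rcases hP.eigenvalues_eq i with h | h <;> rw [← hl] at h <;> simp [h]
  have hcard : Fintype.card {i // l i = 1} = k := by
    have h := hP.trace_eq
    rw [hP.isHermitian.trace_eq_sum_eigenvalues] at h
    have h2 : ∑ i, (l i : ℂ) = (Fintype.card {i // l i = 1} : ℂ) := by
      rw [Finset.sum_congr rfl fun i _ => hl01 i, Fintype.card_subtype]
      simp
    exact_mod_cast h2.symm.trans h
  have hkn : k ≤ n := by
    rw [← hcard]; simpa using Fintype.card_subtype_le (fun i : Fin n => l i = 1)
  have hcard' : Fintype.card {i : Fin n // (i : ℕ) < k} = k := by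
    rw [Fintype.card_subtype]
    simpa [hkn] using Fin.card_filter_val_lt (n := n) (m := k)
  let e : {i : Fin n // (i : ℕ) < k} ≃ {i // l i = 1} :=
    Fintype.equivOfCardEq (hcard'.trans hcard.symm)
  let σ : Equiv.Perm (Fin n) := e.extendSubtype
  have hσ : ∀ i, l (σ i) = 1 ↔ (i : ℕ) < k := by
    intro i
    constructor
    · intro h
      by_contra hi
      exact e.extendSubtype_not_mem i hi h
    · exact e.extendSubtype_mem i
  refine ⟨V.submatrix id σ, ?_, ?_⟩
  · rw [mem_unitaryGroup_iff, star_eq_conjTranspose, conjTranspose_submatrix,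
      submatrix_mul_equiv]
    rw [← star_eq_conjTranspose, mem_unitaryGroup_iff.1 hVm]
    simp
  · have hD : (diagonal fun i : Fin n => if (i : ℕ) < k then (1 : ℂ) else 0) =
        (diagonal fun i => (l i : ℂ)).submatrix σ σ := by
      rw [submatrix_diagonal_equiv]
      congr 1; ext i
      simp only [Function.comp, hl01, hσ]
    rw [hD, star_eq_conjTranspose, conjTranspose_submatrix, submatrix_mul_equiv,
      submatrix_mul_equiv, ← star_eq_conjTranspose, ← hsp]
    simp

end IsRankProj

lemma isRankProj_diagonal_lt {k : ℕ} (hk : k ≤ n) :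
    IsRankProj k (diagonal fun i : Fin n => if (i : ℕ) < k then (1 : ℂ) else 0) := by
  have h := IsRankProj.diagonal_indicator (n := n) (Finset.univ.filter fun i => (i : ℕ) < k)
  have hc : (Finset.univ.filter fun i : Fin n => (i : ℕ) < k).card = k := by
    simpa [hk] using Fin.card_filter_val_lt (n := n) (m := k)
  rw [hc] at h
  simpa using h

lemma jointKNumRange_eq {m k : ℕ} (hk : k ≤ n) (A : Fin m → Matrix (Fin n) (Fin n) ℂ) :
    jointKNumRange k A = {p | ∃ P, IsRankProj k P ∧ ∀ j, p j = (P * A j).trace} := by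
  have key : ∀ C U X : Matrix (Fin n) (Fin n) ℂ,
      (C * (star U * X * U)).trace = (U * C * star U * X).trace := by
    intro C U X
    rw [← mul_assoc, trace_mul_comm]
    simp only [mul_assoc]
  ext p
  constructor
  · rintro ⟨U, hU, h⟩
    exact ⟨_, (isRankProj_diagonal_lt hk).conj hU, fun j => by rw [h j, key]⟩
  · rintro ⟨P, hP, h⟩
    obtain ⟨U, hU, rfl⟩ := hP.exists_unitary
    exact ⟨U, hU, fun j => by rw [h j, key]⟩

lemma Matrix.IsHermitian.commute_of_mul {P A : Matrix (Fin n) (Fin n) ℂ} (hP : P.IsHermitian)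
    (hA : A.IsHermitian) (h : (P * A).IsHermitian) : P * A = A * P := by
  rw [← h.eq, conjTranspose_mul, hP.eq, hA.eq]

lemma IsRankProj.trace_mul_nonneg {k : ℕ} {P B : Matrix (Fin n) (Fin n) ℂ}
    (hP : IsRankProj k P) (hB : B.PosSemidef) : 0 ≤ (P * B).trace.re := by
  have h : (P * B * Pᴴ).PosSemidef := hB.mul_mul_conjTranspose_same P
  have h2 := h.trace_nonneg
  rw [trace_mul_comm, ← mul_assoc, hP.isHermitian.eq, hP.mul_self] at h2
  exact (Complex.le_def.1 h2).1

lemma IsRankProj.mul_eq_zero_of_trace {k : ℕ} {P B : Matrix (Fin n) (Fin n) ℂ}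
    (hP : IsRankProj k P) (hB : B.PosSemidef) (h0 : (P * B).trace.re = 0) : P * B = 0 := by
  have h : (P * B * Pᴴ).PosSemidef := hB.mul_mul_conjTranspose_same P
  have h2 := h.trace_nonneg
  have h3 : (P * B * Pᴴ).trace = (P * B).trace := by
    rw [trace_mul_comm, ← mul_assoc, hP.isHermitian.eq, hP.mul_self]
  have h4 : (P * B * Pᴴ).trace = 0 := by
    apply Complex.ext
    · rw [h3, h0]; rfl
    · exact (Complex.le_def.1 h2).2.symm
  rw [h.trace_eq_zero_iff, hP.isHermitian.eq] at h4
  have h5 : B * P = 0 := by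
    apply Matrix.ext_of_mulVec_single
    intro i
    set x : Fin n → ℂ := Pi.single i 1
    have := (hB.dotProduct_mulVec_zero_iff (P *ᵥ x)).1 (by
      rw [star_mulVec, ← dotProduct_mulVec, hP.isHermitian.eq, mulVec_mulVec, mulVec_mulVec,
        h4]
      simp)
    rw [← mulVec_mulVec, this, zero_mulVec]
  have h6 := congrArg conjTranspose h5
  rwa [conjTranspose_mul, hP.isHermitian.eq, hB.isHermitian.eq, conjTranspose_zero] at h6

/-- `μ` separates the part of `A` on the range of `P` from the part on the kernel of `P`. -/
structure IsThreshold (P A : Matrix (Fin n) (Fin n) ℂ) (μ : ℝ) : Prop where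
  range_nonneg : (P * (A - μ • (1 : Matrix (Fin n) (Fin n) ℂ))).PosSemidef
  ker_nonneg : ((1 - P) * (μ • (1 : Matrix (Fin n) (Fin n) ℂ) - A)).PosSemidef

lemma exists_finset_threshold (f : Fin n → ℝ) {k : ℕ} (hk1 : 1 ≤ k) (hk : k ≤ n) :
    ∃ s : Finset (Fin n), s.card = k ∧ ∃ μ, (∀ i ∈ s, μ ≤ f i) ∧ ∀ i ∉ s, f i ≤ μ := by
  set σ := Tuple.sort fun i => -f i with hσ
  have hmono := Tuple.monotone_sort fun i => -f i
  refine ⟨(Finset.univ.filter fun i : Fin n => (i : ℕ) < k).map σ.toEmbedding, ?_,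
    f (σ ⟨k - 1, by omega⟩), ?_, ?_⟩
  · rw [Finset.card_map]
    simpa [hk] using Fin.card_filter_val_lt (n := n) (m := k)
  · intro i hi
    obtain ⟨j, hj, rfl⟩ := Finset.mem_map.1 hi
    have hj' : (j : ℕ) < k := by simpa using hj
    have := hmono (show j ≤ ⟨k - 1, by omega⟩ from by rw [Fin.le_def]; simp only; omega)
    simpa using this
  · intro i hi
    have hj : ¬ ((σ.symm i : Fin n) : ℕ) < k := by
      intro h
      exact hi (Finset.mem_map.2 ⟨σ.symm i, by simpa using h, by simp⟩)
    have := hmono (show ⟨k - 1, by omega⟩ ≤ σ.symm i from by rw [Fin.le_def]; simp only; omega)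
    simpa [← hσ] using this

lemma exists_isThreshold {A : Matrix (Fin n) (Fin n) ℂ} (hA : A.IsHermitian) {k : ℕ}
    (hk1 : 1 ≤ k) (hk : k ≤ n) : ∃ P μ, IsRankProj k P ∧ IsThreshold P A μ := by
  obtain ⟨s, hs, μ, h1, h2⟩ := exists_finset_threshold hA.eigenvalues hk1 hk
  set V : Matrix (Fin n) (Fin n) ℂ := ↑hA.eigenvectorUnitary with hV
  have hVm : V ∈ unitaryGroup (Fin n) ℂ := hA.eigenvectorUnitary.2
  have hsp : A = V * diagonal (fun i => (hA.eigenvalues i : ℂ)) * star V := by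
    have := hA.spectral_theorem
    simpa [Unitary.conjStarAlgAut_apply, Function.comp_def] using this
  have hone : (1 : Matrix (Fin n) (Fin n) ℂ) = V * 1 * star V := by
    rw [mul_one, mem_unitaryGroup_iff.1 hVm]
  have hmul : ∀ X Y : Matrix (Fin n) (Fin n) ℂ,
      V * X * star V * (V * Y * star V) = V * (X * Y) * star V := by
    intro X Y
    calc V * X * star V * (V * Y * star V) = V * X * (star V * V) * Y * star V := by
          simp only [mul_assoc]
      _ = _ := by rw [mem_unitaryGroup_iff'.1 hVm]; simp only [mul_assoc, one_mul]
  have hsub : ∀ X Y : Matrix (Fin n) (Fin n) ℂ,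
      V * X * star V - V * Y * star V = V * (X - Y) * star V := by
    intro X Y; rw [mul_sub, sub_mul]
  have hsm : μ • (1 : Matrix (Fin n) (Fin n) ℂ) = V * diagonal (fun _ => (μ : ℂ)) * star V := by
    conv_lhs => rw [hone]
    rw [← smul_mul_assoc, ← mul_smul_comm]
    congr 2
    ext i j
    simp [Matrix.diagonal, Matrix.one_apply]
  refine ⟨V * (diagonal fun i => if i ∈ s then (1 : ℂ) else 0) * star V, μ,
    hs ▸ (IsRankProj.diagonal_indicator s).conj hVm, ?_, ?_⟩
  · rw [hsp]
    rw [hsm, hsub, hmul, diagonal_sub, diagonal_mul_diagonal]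
    apply PosSemidef.mul_mul_conjTranspose_same
    apply PosSemidef.diagonal
    intro i
    by_cases hi : i ∈ s
    · simpa [hi, ← Complex.ofReal_sub] using h1 i hi
    · simp [hi]
  · rw [hsp]
    rw [hsm]
    nth_rw 1 [hone]
    rw [hsub, hsub, hmul, diagonal_sub, ← diagonal_one, diagonal_sub, diagonal_mul_diagonal]
    apply PosSemidef.mul_mul_conjTranspose_same
    apply PosSemidef.diagonal
    intro i
    by_cases hi : i ∈ s
    · simp [hi]
    · simpa [hi, ← Complex.ofReal_sub] using h2 i hi

/-- A projection with a threshold maximizes the trace, and other maximizers have the same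
positive part. -/
lemma IsThreshold.mul_eq {k : ℕ} {P Q A : Matrix (Fin n) (Fin n) ℂ} {μ : ℝ} (hk : k ≤ n)
    (hP : IsRankProj k P) (hQ : IsRankProj k Q) (h : IsThreshold P A μ)
    (hle : (P * A).trace.re ≤ (Q * A).trace.re) :
    Q * (A - μ • (1 : Matrix (Fin n) (Fin n) ℂ)) =
      P * (A - μ • (1 : Matrix (Fin n) (Fin n) ℂ)) := by
  set B := A - μ • (1 : Matrix (Fin n) (Fin n) ℂ) with hB
  have hneg : μ • (1 : Matrix (Fin n) (Fin n) ℂ) - A = -B := by rw [hB]; abel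
  have h1 := h.range_nonneg
  have h2 := h.ker_nonneg
  rw [hneg] at h2
  have hQ' := hQ.one_sub hk
  have e1 := hQ'.trace_mul_nonneg h1
  have e2 := hQ.trace_mul_nonneg h2
  have tB : ∀ X : Matrix (Fin n) (Fin n) ℂ, IsRankProj k X →
      (X * B).trace.re = (X * A).trace.re - μ * k := by
    intro X hX
    rw [hB, mul_sub, trace_sub, mul_smul_comm, mul_one, trace_smul, hX.trace_eq]
    simp
  have e3 : ((1 - Q) * (P * B)).trace.re + (Q * ((1 - P) * -B)).trace.re =
      (P * A).trace.re - (Q * A).trace.re := by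
    rw [← Complex.add_re, ← trace_add]
    have : (1 - Q) * (P * B) + Q * ((1 - P) * -B) = P * B - Q * B := by noncomm_ring
    rw [this, trace_sub, Complex.sub_re, tB P hP, tB Q hQ]
    ring
  have z1 := hQ'.mul_eq_zero_of_trace h1 (by linarith)
  have z2 := hQ.mul_eq_zero_of_trace h2 (by linarith)
  have : P * B - Q * B = (1 - Q) * (P * B) + Q * ((1 - P) * -B) := by noncomm_ring
  rw [z1, z2, add_zero] at this
  exact (sub_eq_zero.1 this).symm

lemma IsMaxProj.exists_threshold {k : ℕ} {P A : Matrix (Fin n) (Fin n) ℂ} (hk1 : 1 ≤ k)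
    (hk : k ≤ n) (hA : A.IsHermitian) (h : IsMaxProj k P A) : ∃ μ, IsThreshold P A μ := by
  obtain ⟨Q, μ, hQ, hQμ⟩ := exists_isThreshold hA hk1 hk
  have e := hQμ.mul_eq hk hQ h.1 (h.2 Q hQ)
  have hneg : μ • (1 : Matrix (Fin n) (Fin n) ℂ) - A =
    -(A - μ • (1 : Matrix (Fin n) (Fin n) ℂ)) := by abel
  refine ⟨μ, e ▸ hQμ.range_nonneg, ?_⟩
  have := hQμ.ker_nonneg
  rwa [hneg, sub_mul, mul_neg Q, ← e, ← mul_neg P, ← sub_mul, ← hneg] at this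

lemma isHermitian_sub_smul_one {A : Matrix (Fin n) (Fin n) ℂ} (hA : A.IsHermitian) (μ : ℝ) :
    (A - μ • (1 : Matrix (Fin n) (Fin n) ℂ)).IsHermitian := by
  refine hA.sub ?_
  rw [IsHermitian, conjTranspose_smul]
  simp

lemma IsThreshold.commute {P A : Matrix (Fin n) (Fin n) ℂ} {μ : ℝ} (hP : P.IsHermitian)
    (hA : A.IsHermitian) (h : IsThreshold P A μ) : P * A = A * P := by
  have := hP.commute_of_mul (isHermitian_sub_smul_one hA μ) h.range_nonneg.isHermitian
  rw [mul_sub, sub_mul] at this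
  simpa using this

lemma IsMaxProj.commute {k : ℕ} {P A : Matrix (Fin n) (Fin n) ℂ} (hk1 : 1 ≤ k)
    (hk : k ≤ n) (hA : A.IsHermitian) (h : IsMaxProj k P A) : P * A = A * P := by
  obtain ⟨μ, hμ⟩ := h.exists_threshold hk1 hk hA
  exact hμ.commute h.1.isHermitian hA

lemma IsMaxProj.one_sub {k : ℕ} {P A : Matrix (Fin n) (Fin n) ℂ} (hk : k ≤ n)
    (h : IsMaxProj k P A) : IsMaxProj (n - k) (1 - P) (-A) := by
  refine ⟨h.1.one_sub hk, fun Q hQ => ?_⟩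
  have hQ' := hQ.one_sub (Nat.sub_le n k)
  rw [Nat.sub_sub_self hk] at hQ'
  have := h.2 _ hQ'
  simp only [sub_mul, one_mul, mul_neg, trace_neg, trace_sub, Complex.neg_re,
    Complex.sub_re] at this ⊢
  linarith

lemma IsRankProj.finrank_range {k : ℕ} {P : Matrix (Fin n) (Fin n) ℂ} (hP : IsRankProj k P) :
    Module.finrank ℂ (LinearMap.range P.mulVecLin) = k := by
  have hid : IsIdempotentElem P.mulVecLin := by
    rw [IsIdempotentElem, Module.End.mul_eq_comp, ← mulVecLin_mul, hP.mul_self]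
  have h := (LinearMap.IsIdempotentElem.isProj_range _ hid).trace
  have h2 : LinearMap.trace ℂ (Fin n → ℂ) P.mulVecLin = P.trace := trace_toLin'_eq P
  rw [h2, hP.trace_eq] at h
  exact_mod_cast h.symm

lemma IsRankProj.mulVec_of_mem_range {k : ℕ} {P : Matrix (Fin n) (Fin n) ℂ}
    (hP : IsRankProj k P) {x : Fin n → ℂ} (hx : x ∈ LinearMap.range P.mulVecLin) :
    P *ᵥ x = x := by
  obtain ⟨y, rfl⟩ := hx
  rw [mulVecLin_apply, mulVec_mulVec, hP.mul_self]

/-- The commutator kills the difference of two maximizing projections that commute with both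
matrices. -/
lemma IsMaxProj.commutator_mul_eq {k : ℕ} {A B P Q : Matrix (Fin n) (Fin n) ℂ} (hk1 : 1 ≤ k)
    (hk : k ≤ n) (hA : A.IsHermitian) (hP : IsMaxProj k P A) (hQ : IsMaxProj k Q A)
    (hPB : P * B = B * P) (hQB : Q * B = B * Q) :
    (A * B - B * A) * P = (A * B - B * A) * Q := by
  obtain ⟨μ, hμ⟩ := hP.exists_threshold hk1 hk hA
  have e := hμ.mul_eq hk hP.1 hQ.1 (hQ.2 P hP.1)
  have hPA := hP.commute hk1 hk hA
  have hQA := hQ.commute hk1 hk hA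
  have hD : A * (P - Q) = μ • (P - Q) := by
    rw [mul_sub, mul_sub] at e
    simp only [mul_smul_comm, mul_one] at e
    rw [mul_sub, ← hPA, ← hQA, smul_sub]
    exact sub_eq_sub_iff_sub_eq_sub.1 e.symm
  have hDB : (P - Q) * B = B * (P - Q) := by rw [sub_mul, mul_sub, hPB, hQB]
  rw [← sub_eq_zero, ← mul_sub, sub_mul, mul_assoc, mul_assoc, hD, ← hDB, ← mul_assoc, hD]
  simp [hDB]

/-- The commutator of Hermitian matrices vanishes on `ker P` once it vanishes on a subspace
containing its image on `ker P`. -/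
lemma commutator_mul_one_sub_eq_zero {A B P : Matrix (Fin n) (Fin n) ℂ}
    (hA : A.IsHermitian) (hB : B.IsHermitian)
    (h : (A * B - B * A) * ((A * B - B * A) * (1 - P)) = 0) :
    (A * B - B * A) * (1 - P) = 0 := by
  set K := A * B - B * A with hK
  have hKs : Kᴴ = -K := by
    rw [hK, conjTranspose_sub, conjTranspose_mul, conjTranspose_mul, hA.eq, hB.eq]
    abel
  rw [← conjTranspose_mul_self_eq_zero, conjTranspose_mul, hKs, mul_assoc, neg_mul, h]
  simp

lemma IsMaxProj.commutator_of_neg {k : ℕ} {A B P : Matrix (Fin n) (Fin n) ℂ} (hk1 : 1 ≤ k)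
    (hk : k ≤ n) (hA : A.IsHermitian) (hP : IsMaxProj k P A) (hP' : IsMaxProj k P (-A))
    (hPB : P * B = B * P) : (A * B - B * A) * (1 - P) = 0 := by
  obtain ⟨μ, hμ⟩ := hP.exists_threshold hk1 hk hA
  obtain ⟨ν, hν⟩ := hP'.exists_threshold hk1 hk hA.neg
  have hP0 : P ≠ 0 := by
    rintro rfl
    have := hP.1.trace_eq
    simp only [trace_zero] at this
    have : k = 0 := by exact_mod_cast this.symm
    omega
  have hPpsd : P.PosSemidef := by
    have := posSemidef_conjTranspose_mul_self P
    rwa [hP.1.isHermitian.eq, hP.1.mul_self] at this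
  have hle : μ ≤ -ν := by
    have h := (hμ.range_nonneg.add hν.range_nonneg).trace_nonneg
    have e : P * (A - μ • (1 : Matrix (Fin n) (Fin n) ℂ)) +
        P * (-A - ν • (1 : Matrix (Fin n) (Fin n) ℂ)) = (-μ - ν) • P := by
      simp only [mul_sub, mul_neg, mul_smul_comm, mul_one, sub_smul, neg_smul]
      abel
    rw [e, trace_smul, hP.1.trace_eq] at h
    have h2 := (Complex.le_def.1 h).1
    simp only [Complex.zero_re, Complex.smul_re, Complex.natCast_re, smul_eq_mul] at h2
    have hk0 : (0 : ℝ) < k := by exact_mod_cast hk1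
    have := nonneg_of_mul_nonneg_left h2 hk0
    linarith
  have hPA := hP.commute hk1 hk hA
  have hL : (1 - P).PosSemidef := by
    have := posSemidef_conjTranspose_mul_self (1 - P)
    have h1 := hP.1.one_sub hk
    rwa [h1.isHermitian.eq, h1.mul_self] at this
  have hzero : (1 - P) * (μ • (1 : Matrix (Fin n) (Fin n) ℂ) - A) = 0 := by
    rw [← hμ.ker_nonneg.trace_eq_zero_iff]
    apply le_antisymm _ hμ.ker_nonneg.trace_nonneg
    have e : (1 - P) * (μ • (1 : Matrix (Fin n) (Fin n) ℂ) - A) =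
        (μ + ν) • (1 - P) - (1 - P) * (ν • (1 : Matrix (Fin n) (Fin n) ℂ) - -A) := by
      simp only [mul_sub, mul_neg, mul_smul_comm, mul_one, add_smul]
      abel
    rw [e, trace_sub, sub_nonpos]
    refine le_trans ?_ hν.ker_nonneg.trace_nonneg
    rw [trace_smul]
    exact smul_nonpos_of_nonpos_of_nonneg (by linarith) hL.trace_nonneg
  have hLA : A * (1 - P) = μ • (1 - P) := by
    rw [mul_sub] at hzero
    simp only [mul_smul_comm, mul_one] at hzero
    have : A * (1 - P) = (1 - P) * A := by rw [mul_sub, sub_mul, hPA, mul_one, one_mul]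
    rw [this]
    exact (sub_eq_zero.1 hzero).symm
  have hLB : (1 - P) * B = B * (1 - P) := by rw [mul_sub, sub_mul, hPB, mul_one, one_mul]
  rw [sub_mul, mul_assoc, mul_assoc, hLA, ← hLB, ← mul_assoc, hLA]
  simp [hLB]

lemma mulVec_commutator (A B : Matrix (Fin n) (Fin n) ℂ) (x : Fin n → ℂ) :
    (A * B - B * A) *ᵥ x = A *ᵥ (B *ᵥ x) - B *ᵥ (A *ᵥ x) := by
  rw [sub_mulVec, mulVec_mulVec, mulVec_mulVec]

lemma commutator_mulVec_of_finrank_le_one {A B : Matrix (Fin n) (Fin n) ℂ}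
    {E : Submodule ℂ (Fin n → ℂ)} (hE : Module.finrank ℂ E ≤ 1) (hEA : ∀ x ∈ E, A *ᵥ x ∈ E)
    (hEB : ∀ x ∈ E, B *ᵥ x ∈ E) {x : Fin n → ℂ} (hx : x ∈ E) :
    (A * B - B * A) *ᵥ x = 0 := by
  obtain ⟨v, hv⟩ := finrank_le_one_iff.1 hE
  have hv' : ∀ w ∈ E, ∃ c : ℂ, c • (v : Fin n → ℂ) = w := fun w hw => by
    obtain ⟨c, hc⟩ := hv ⟨w, hw⟩
    exact ⟨c, congrArg Subtype.val hc⟩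
  obtain ⟨a, ha⟩ := hv' _ (hEA v v.2)
  obtain ⟨b, hb⟩ := hv' _ (hEB v v.2)
  obtain ⟨c, rfl⟩ := hv' x hx
  rw [mulVec_smul, mulVec_commutator, ← ha, ← hb, mulVec_smul, mulVec_smul, ← ha, ← hb,
    smul_comm, sub_self, smul_zero]

lemma IsMaxProj.commutator_of_ne {k : ℕ} {A B P Q R : Matrix (Fin n) (Fin n) ℂ} (hk1 : 1 ≤ k)
    (hk : k ≤ n) (hn : n ≤ 2 * k + 2) (hA : A.IsHermitian) (hB : B.IsHermitian)
    (hP : IsMaxProj k P A) (hQ : IsMaxProj k Q A) (hR : IsMaxProj k R (-A))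
    (hPB : P * B = B * P) (hQB : Q * B = B * Q) (hRB : R * B = B * R) (hne : P ≠ Q)
    (hPR : (A * B - B * A) * P = (A * B - B * A) * R) :
    (A * B - B * A) * (1 - P) = 0 := by
  have hPQ := hP.commutator_mul_eq hk1 hk hA hQ hPB hQB
  have hPA := hP.commute hk1 hk hA
  have hQA := hQ.commute hk1 hk hA
  have hRA : R * A = A * R := by simpa using hR.commute hk1 hk hA.neg
  have hKcomm : ∀ X : Matrix (Fin n) (Fin n) ℂ, X * A = A * X → X * B = B * X →
      X * (A * B - B * A) = (A * B - B * A) * X := by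
    intro X h1 h2
    rw [mul_sub, sub_mul, ← mul_assoc, ← mul_assoc, h1, h2, mul_assoc, mul_assoc, h1, h2,
      mul_assoc, mul_assoc]
  set E : Submodule ℂ (Fin n → ℂ) :=
    LinearMap.ker P.mulVecLin ⊓ LinearMap.ker Q.mulVecLin ⊓ LinearMap.ker R.mulVecLin with hEdef
  have memE : ∀ x, x ∈ E ↔ (P *ᵥ x = 0 ∧ Q *ᵥ x = 0) ∧ R *ᵥ x = 0 := by
    intro x
    simp [hEdef]
  have hinv : ∀ X : Matrix (Fin n) (Fin n) ℂ, P * X = X * P → Q * X = X * Q → R * X = X * R →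
      ∀ x ∈ E, X *ᵥ x ∈ E := by
    intro X h1 h2 h3 x hx
    rw [memE] at hx ⊢
    obtain ⟨⟨hx1, hx2⟩, hx3⟩ := hx
    simp only [mulVec_mulVec, h1, h2, h3]
    simp only [← mulVec_mulVec, hx1, hx2, hx3, mulVec_zero, and_self]
  have hEA := hinv A hPA hQA hRA
  have hEB := hinv B hPB hQB hRB
  have hker : (∀ x ∈ E, (A * B - B * A) *ᵥ x = 0) → (A * B - B * A) * (1 - P) = 0 := by
    intro h
    apply commutator_mul_one_sub_eq_zero hA hB
    apply Matrix.ext_of_mulVec_single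
    intro i
    rw [← mulVec_mulVec, zero_mulVec]
    apply h
    rw [memE]
    have hkill : ∀ X : Matrix (Fin n) (Fin n) ℂ, IsRankProj k X → X * A = A * X →
        X * B = B * X → (A * B - B * A) * P = (A * B - B * A) * X →
        X *ᵥ (((A * B - B * A) * (1 - P)) *ᵥ Pi.single i 1) = 0 := by
      intro X hX h1 h2 h3
      rw [mulVec_mulVec, mul_sub, mul_one, h3, mul_sub, ← mul_assoc, hKcomm X h1 h2, mul_assoc,
        hX.mul_self, sub_self, zero_mulVec]
    exact ⟨⟨hkill P hP.1 hPA hPB rfl, hkill Q hQ.1 hQA hQB hPQ⟩, hkill R hR.1 hRA hRB hPR⟩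
  apply hker
  rcases le_or_gt (Module.finrank ℂ E) 1 with hE1 | hE2
  · exact fun x hx => commutator_mulVec_of_finrank_le_one hE1 hEA hEB hx
  obtain ⟨μ, hμ⟩ := hP.exists_threshold hk1 hk hA
  obtain ⟨ν, hν⟩ := hR.exists_threshold hk1 hk hA.neg
  have hQP := hμ.mul_eq hk hP.1 hQ.1 (hQ.2 P hP.1)
  set C := A - μ • (1 : Matrix (Fin n) (Fin n) ℂ) with hC
  have hPC : P * C = C * P := by
    rw [hC, mul_sub, sub_mul, hPA]; simp
  have hQC : Q * C = C * Q := by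
    rw [hC, mul_sub, sub_mul, hQA]; simp
  have hsa : ∀ X : Matrix (Fin n) (Fin n) ℂ, X.IsHermitian → ∀ x y : Fin n → ℂ,
      star x ⬝ᵥ X *ᵥ y = star (X *ᵥ x) ⬝ᵥ y := by
    intro X hX x y
    rw [star_mulVec, ← dotProduct_mulVec, hX.eq]
  have hμν : μ ≤ -ν := by
    by_contra hlt
    push Not at hlt
    set G := LinearMap.range P.mulVecLin ⊔ LinearMap.range Q.mulVecLin with hG
    have hGlt : LinearMap.range P.mulVecLin < G := by
      refine lt_of_le_of_ne le_sup_left fun heq => hne ?_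
      have hle : LinearMap.range Q.mulVecLin ≤ LinearMap.range P.mulVecLin := by
        rw [heq]; exact le_sup_right
      have heq2 := Submodule.eq_of_le_of_finrank_eq hle
        (by rw [hP.1.finrank_range, hQ.1.finrank_range])
      have e1 : P * Q = Q := by
        apply Matrix.ext_of_mulVec_single
        intro i
        rw [← mulVec_mulVec]
        exact hP.1.mulVec_of_mem_range (hle ⟨_, rfl⟩)
      have e2 : Q * P = P := by
        apply Matrix.ext_of_mulVec_single
        intro i
        rw [← mulVec_mulVec]
        exact hQ.1.mulVec_of_mem_range (heq2 ▸ ⟨_, rfl⟩)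
      rw [← hP.1.isHermitian.eq, ← e2, conjTranspose_mul, hP.1.isHermitian.eq,
        hQ.1.isHermitian.eq, e1]
    have hGk := Submodule.finrank_lt_finrank_of_lt hGlt
    rw [hP.1.finrank_range] at hGk
    have hdisj : Disjoint (G ⊔ LinearMap.range R.mulVecLin) E := by
      rw [Submodule.disjoint_def]
      intro x hx hxE
      obtain ⟨y, hy, z, ⟨c, rfl⟩, rfl⟩ := Submodule.mem_sup.1 hx
      obtain ⟨u, ⟨a, rfl⟩, v, ⟨b, rfl⟩, rfl⟩ := Submodule.mem_sup.1 hy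
      simp only [mulVecLin_apply] at hxE ⊢
      set x := P *ᵥ a + Q *ᵥ b + R *ᵥ c with hxdef
      rw [memE] at hxE
      rw [← dotProduct_star_self_eq_zero]
      nth_rw 2 [hxdef]
      rw [dotProduct_add, dotProduct_add, hsa P hP.1.isHermitian, hsa Q hQ.1.isHermitian,
        hsa R hR.1.isHermitian, hxE.1.1, hxE.1.2, hxE.2]
      simp
    have hd1 := Submodule.finrank_add_finrank_le_of_disjoint hdisj
    have hd2 := Submodule.finrank_sup_add_finrank_inf_eq G (LinearMap.range R.mulVecLin)
    rw [hR.1.finrank_range] at hd2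
    rw [Module.finrank_fin_fun] at hd1
    have hpos : 0 < Module.finrank ℂ ↥(G ⊓ LinearMap.range R.mulVecLin) := by omega
    obtain ⟨⟨x, hxG, hxR⟩, hx0⟩ := (Module.finrank_pos_iff_exists_ne_zero (R := ℂ)).1 hpos
    have hx0 : x ≠ 0 := fun h => hx0 (by ext1; exact h)
    have hxpos : 0 < (star x ⬝ᵥ x).re :=
      (Complex.lt_def.1 (dotProduct_star_self_pos_iff.2 hx0)).1
    have h1 : C *ᵥ x = (P * C) *ᵥ x := by
      obtain ⟨u, ⟨a, rfl⟩, v, ⟨b, rfl⟩, rfl⟩ := Submodule.mem_sup.1 hxG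
      simp only [mulVecLin_apply, mulVec_add, mulVec_mulVec]
      congr 2
      · rw [hPC, mul_assoc, hP.1.mul_self]
      · rw [← hQP, hQC, mul_assoc, hQ.1.mul_self]
    have h2 := hμ.range_nonneg.re_dotProduct_nonneg x
    rw [← h1] at h2
    have h3 := hν.range_nonneg.re_dotProduct_nonneg x
    rw [← mulVec_mulVec, hsa R hR.1.isHermitian, hR.1.mulVec_of_mem_range hxR] at h3
    simp only [hC, sub_mulVec, neg_mulVec, smul_mulVec, one_mulVec, dotProduct_sub,
      dotProduct_neg, dotProduct_smul, map_sub, map_neg, RCLike.re_to_complex,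
      Complex.smul_re, smul_eq_mul] at h2 h3
    nlinarith
  have hscal : ∀ x ∈ E, A *ᵥ x = μ • x := by
    intro x hx
    have hxE := (memE x).1 hx
    have hneg : μ • (1 : Matrix (Fin n) (Fin n) ℂ) - A = -C := by rw [hC]; abel
    have h1 := hμ.ker_nonneg
    have h2 := h1.dotProduct_mulVec_nonneg x
    have h3 := hν.ker_nonneg.dotProduct_mulVec_nonneg x
    have hcollapse : ∀ X Y : Matrix (Fin n) (Fin n) ℂ, X * Y = Y * X → X *ᵥ x = 0 →
        ((1 - X) * Y) *ᵥ x = Y *ᵥ x := by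
      intro X Y hXY hX
      rw [sub_mul, one_mul, sub_mulVec, hXY, ← mulVec_mulVec, hX, mulVec_zero, sub_zero]
    have h4 := hcollapse P (μ • 1 - A) (by rw [hneg]; simpa using hPC) hxE.1.1
    have h5 := hcollapse R (ν • 1 - -A) (by rw [mul_sub, sub_mul]; simpa using hRA) hxE.2
    have hz := (h1.dotProduct_mulVec_zero_iff x).1 (by
      apply le_antisymm _ h2
      have e : ((1 - P) * (μ • 1 - A)) *ᵥ x =
          (μ + ν) • x - ((1 - R) * (ν • 1 - -A)) *ᵥ x := by
        rw [h4, h5]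
        simp only [sub_mulVec, neg_mulVec, smul_mulVec, one_mulVec, add_smul]
        abel
      rw [e, dotProduct_sub, sub_nonpos]
      refine le_trans ?_ h3
      rw [dotProduct_smul]
      exact smul_nonpos_of_nonpos_of_nonneg (by linarith) (dotProduct_star_self_nonneg x))
    rw [h4, sub_mulVec, smul_mulVec, one_mulVec] at hz
    exact (sub_eq_zero.1 hz).symm
  intro x hx
  rw [mulVec_commutator, hscal x hx, hscal _ (hEB x hx), mulVec_smul, sub_self]

lemma forall_of_isClosed_cover {ι X : Type*} [TopologicalSpace X] [PreconnectedSpace X]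
    {S : Set ι} (hS : S.Finite) {C : ι → Set X} (hC : ∀ i, IsClosed (C i))
    (hcover : ∀ x, ∃ i ∈ S, x ∈ C i) {p : ι → Prop}
    (hp : ∀ i ∈ S, ∀ j ∈ S, (C i ∩ C j).Nonempty → p i → p j) {i : ι} (hi : i ∈ S)
    (hpi : p i) (hne : (C i).Nonempty) : ∀ j ∈ S, (C j).Nonempty → p j := by
  intro j hj hjne
  by_contra hpj
  have hcl : ∀ q : ι → Prop, IsClosed (⋃ i ∈ {i ∈ S | q i}, C i) := fun q =>
    (hS.subset (Set.sep_subset _ _)).isClosed_biUnion fun i _ => hC i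
  obtain ⟨x, hx⟩ := hne
  obtain ⟨y, hy⟩ := hjne
  obtain ⟨z, -, hz1, hz2⟩ := isPreconnected_closed_iff.1 (isPreconnected_univ (α := X)) _ _
    (hcl p) (hcl fun i => ¬ p i) (by
      intro z _
      obtain ⟨l, hl, hzl⟩ := hcover z
      by_cases h : p l
      · exact Or.inl (Set.mem_biUnion (show l ∈ {i ∈ S | p i} from ⟨hl, h⟩) hzl)
      · exact Or.inr (Set.mem_biUnion (show l ∈ {i ∈ S | ¬ p i} from ⟨hl, h⟩) hzl))
    ⟨x, Set.mem_univ _, Set.mem_biUnion (show i ∈ {i ∈ S | p i} from ⟨hi, hpi⟩) hx⟩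
    ⟨y, Set.mem_univ _, Set.mem_biUnion (show j ∈ {i ∈ S | ¬ p i} from ⟨hj, hpj⟩) hy⟩
  simp only [Set.mem_iUnion, exists_prop, Set.mem_ofPred_eq] at hz1 hz2
  obtain ⟨a, ⟨ha, hpa⟩, hza⟩ := hz1
  obtain ⟨b, ⟨hb, hpb⟩, hzb⟩ := hz2
  exact hpb (hp a ha b hb ⟨z, hza, hzb⟩ hpa)

/-- The rotated matrix `cos t • A + sin t • B`. -/
noncomputable def rotate (A B : Matrix (Fin n) (Fin n) ℂ) (t : ℝ) : Matrix (Fin n) (Fin n) ℂ :=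
  Real.cos t • A + Real.sin t • B

lemma isHermitian_real_smul {A : Matrix (Fin n) (Fin n) ℂ} (hA : A.IsHermitian) (c : ℝ) :
    (c • A).IsHermitian := by
  rw [IsHermitian, conjTranspose_smul, hA.eq]
  simp

lemma isHermitian_rotate {A B : Matrix (Fin n) (Fin n) ℂ} (hA : A.IsHermitian)
    (hB : B.IsHermitian) (t : ℝ) : (rotate A B t).IsHermitian :=
  (isHermitian_real_smul hA _).add (isHermitian_real_smul hB _)

lemma commutator_rotate (A B : Matrix (Fin n) (Fin n) ℂ) (s t : ℝ) :
    rotate A B s * rotate A B t - rotate A B t * rotate A B s =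
      Real.sin (t - s) • (A * B - B * A) := by
  simp only [rotate, add_mul, mul_add, smul_mul_assoc, mul_smul_comm, Real.sin_sub]
  module

lemma rotate_add_pi (A B : Matrix (Fin n) (Fin n) ℂ) (t : ℝ) :
    rotate A B (t + Real.pi) = -rotate A B t := by
  simp [rotate, Real.cos_add_pi, Real.sin_add_pi]
  abel

lemma commutator_rotate_perp (A B : Matrix (Fin n) (Fin n) ℂ) (t : ℝ) :
    rotate A B t * rotate A B (t + Real.pi / 2) - rotate A B (t + Real.pi / 2) * rotate A B t =
      A * B - B * A := by
  rw [commutator_rotate]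
  simp

lemma trace_mul_rotate_re (A B P : Matrix (Fin n) (Fin n) ℂ) (t : ℝ) :
    (P * rotate A B t).trace.re =
      Real.cos t * (P * A).trace.re + Real.sin t * (P * B).trace.re := by
  simp [rotate, mul_add, trace_add, trace_smul, Complex.cos_ofReal_re, Complex.sin_ofReal_re]

lemma isClosed_isMaxProj_rotate (k : ℕ) (A B P : Matrix (Fin n) (Fin n) ℂ) :
    IsClosed {t | IsMaxProj k P (rotate A B t)} := by
  by_cases hP : IsRankProj k P
  · have : {t | IsMaxProj k P (rotate A B t)} = ⋂ Q, ⋂ (_ : IsRankProj k Q),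
        {t | (Q * rotate A B t).trace.re ≤ (P * rotate A B t).trace.re} := by
      ext t
      simp [IsMaxProj, hP]
    rw [this]
    refine isClosed_iInter fun Q => isClosed_iInter fun _ => ?_
    simp only [trace_mul_rotate_re]
    exact isClosed_le (by fun_prop) (by fun_prop)
  · simp [IsMaxProj, hP]

lemma commute_rotate {A B P : Matrix (Fin n) (Fin n) ℂ} (hA : P * A = A * P)
    (hB : P * B = B * P) (t : ℝ) : P * rotate A B t = rotate A B t * P := by
  simp [rotate, mul_add, add_mul, hA, hB]

/-- If finitely many projections commuting with `A` and `B` suffice to maximize every rotated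
trace, then the commutator vanishes on the kernels of these projections. -/
lemma commutator_mul_one_sub_of_cover {k : ℕ} {A B : Matrix (Fin n) (Fin n) ℂ} (hk1 : 1 ≤ k)
    (hk : k ≤ n) (hn : n ≤ 2 * k + 2) (hA : A.IsHermitian) (hB : B.IsHermitian)
    {S : Set (Matrix (Fin n) (Fin n) ℂ)} (hS : S.Finite)
    (hSA : ∀ P ∈ S, P * A = A * P) (hSB : ∀ P ∈ S, P * B = B * P)
    (hcover : ∀ t, ∃ P ∈ S, IsMaxProj k P (rotate A B t)) :
    ∀ P ∈ S, ∀ t, IsMaxProj k P (rotate A B t) → (A * B - B * A) * (1 - P) = 0 := by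
  have hrot := isHermitian_rotate hA hB
  have hcl := isClosed_isMaxProj_rotate k A B
  have hconst : ∀ P ∈ S, ∀ t, IsMaxProj k P (rotate A B t) → ∀ Q ∈ S, ∀ s,
      IsMaxProj k Q (rotate A B s) → (A * B - B * A) * P = (A * B - B * A) * Q := by
    intro P hP t ht Q hQ s hs
    refine (forall_of_isClosed_cover hS hcl hcover
      (p := fun X => (A * B - B * A) * P = (A * B - B * A) * X) ?_ hP rfl ⟨t, ht⟩ Q hQ ⟨s, hs⟩)
    rintro X hX Y hY ⟨r, hrX, hrY⟩ h
    have := hrX.commutator_mul_eq hk1 hk (hrot r) hrY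
      (commute_rotate (hSA X hX) (hSB X hX) (r + Real.pi / 2))
      (commute_rotate (hSA Y hY) (hSB Y hY) (r + Real.pi / 2))
    rw [commutator_rotate_perp] at this
    exact h.trans this
  intro P hP t ht
  by_cases hedge : ∃ X ∈ S, ∃ Y ∈ S, ∃ r, IsMaxProj k X (rotate A B r) ∧
      IsMaxProj k Y (rotate A B r) ∧ X ≠ Y
  · obtain ⟨X, hX, Y, hY, r, hrX, hrY, hXY⟩ := hedge
    obtain ⟨R, hR, hrR⟩ := hcover (r + Real.pi)
    have h := hrX.commutator_of_ne hk1 hk hn (hrot r) (hrot (r + Real.pi / 2)) hrY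
      (by rwa [rotate_add_pi] at hrR) (commute_rotate (hSA X hX) (hSB X hX) _)
      (commute_rotate (hSA Y hY) (hSB Y hY) _) (commute_rotate (hSA R hR) (hSB R hR) _) hXY
      (by rw [commutator_rotate_perp]; exact hconst X hX r hrX R hR _ hrR)
    rw [commutator_rotate_perp] at h
    rw [mul_sub, hconst P hP t ht X hX r hrX, ← mul_sub, h]
  · push Not at hedge
    obtain ⟨R, hR, hrR⟩ := hcover (t + Real.pi)
    have hPR : P = R := forall_of_isClosed_cover hS hcl hcover (p := fun X => P = X)
      (by
        rintro X hX Y hY ⟨r, hrX, hrY⟩ h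
        exact h.trans (hedge X hX Y hY r hrX hrY)) hP rfl ⟨t, ht⟩ R hR ⟨_, hrR⟩
    have h := ht.commutator_of_neg (B := rotate A B (t + Real.pi / 2)) hk1 hk (hrot t)
      (by rwa [rotate_add_pi, ← hPR] at hrR) (commute_rotate (hSA P hP) (hSB P hP) _)
    rwa [commutator_rotate_perp] at h

lemma commute_of_cover {k : ℕ} {A B : Matrix (Fin n) (Fin n) ℂ} (hk1 : 1 ≤ k)
    (hk : k + 1 ≤ n) (hn1 : n ≤ 2 * k + 2) (hn2 : 2 * k ≤ n + 2) (hA : A.IsHermitian)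
    (hB : B.IsHermitian) {S : Set (Matrix (Fin n) (Fin n) ℂ)} (hS : S.Finite)
    (hSA : ∀ P ∈ S, P * A = A * P) (hSB : ∀ P ∈ S, P * B = B * P)
    (hcover : ∀ t, ∃ P ∈ S, IsMaxProj k P (rotate A B t)) : A * B = B * A := by
  obtain ⟨P, hP, hmax⟩ := hcover 0
  have h1 := commutator_mul_one_sub_of_cover hk1 (by omega) hn1 hA hB hS hSA hSB hcover P hP 0
    hmax
  have hneg : ∀ t, rotate (-A) (-B) t = -rotate A B t := by
    intro t
    simp [rotate]
    abel
  have h2 := commutator_mul_one_sub_of_cover (k := n - k) (A := -A) (B := -B)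
    (S := (fun X => 1 - X) '' S) (by omega) (Nat.sub_le n k) (by omega) hA.neg hB.neg
    (hS.image _)
    (by rintro _ ⟨X, hX, rfl⟩; simp [sub_mul, mul_sub, hSA X hX]; abel)
    (by rintro _ ⟨X, hX, rfl⟩; simp [sub_mul, mul_sub, hSB X hX]; abel)
    (by
      intro t
      obtain ⟨X, hX, hXt⟩ := hcover t
      exact ⟨_, ⟨X, hX, rfl⟩, hneg t ▸ hXt.one_sub (by omega)⟩)
    (1 - P) ⟨P, hP, rfl⟩ 0 (hneg 0 ▸ hmax.one_sub (by omega))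
  simp only [neg_mul_neg, sub_sub_cancel] at h2
  have : A * B - B * A = (A * B - B * A) * (1 - P) + (A * B - B * A) * P := by noncomm_ring
  rw [h1, h2, add_zero] at this
  exact sub_eq_zero.1 this

lemma commute_of_commute_rotate {A B P : Matrix (Fin n) (Fin n) ℂ} {s t : ℝ}
    (hst : Real.sin (t - s) ≠ 0) (hs : P * rotate A B s = rotate A B s * P)
    (ht : P * rotate A B t = rotate A B t * P) : P * A = A * P ∧ P * B = B * P := by
  have eA : Real.sin (t - s) • A = Real.sin t • rotate A B s - Real.sin s • rotate A B t := by
    rw [Real.sin_sub]; simp only [rotate]; module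
  have eB : Real.sin (t - s) • B = Real.cos s • rotate A B t - Real.cos t • rotate A B s := by
    rw [Real.sin_sub]; simp only [rotate]; module
  constructor
  · have : Real.sin (t - s) • (P * A) = Real.sin (t - s) • (A * P) := by
      rw [← mul_smul_comm, ← smul_mul_assoc, eA]
      simp only [mul_sub, sub_mul, mul_smul_comm, smul_mul_assoc, hs, ht]
    exact smul_right_injective _ hst this
  · have : Real.sin (t - s) • (P * B) = Real.sin (t - s) • (B * P) := by
      rw [← mul_smul_comm, ← smul_mul_assoc, eB]
      simp only [mul_sub, sub_mul, mul_smul_comm, smul_mul_assoc, hs, ht]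
    exact smul_right_injective _ hst this

lemma countable_setOf_sin_sub_eq_zero (s : ℝ) : {t | Real.sin (t - s) = 0}.Countable := by
  refine (Set.countable_range fun m : ℤ => (m : ℝ) * Real.pi + s).mono ?_
  intro t ht
  obtain ⟨m, hm⟩ := Real.sin_eq_zero_iff.1 ht
  exact ⟨m, by simp only; linarith⟩

/-- If finitely many projections suffice to maximize every rotated trace, then `A` and `B`
commute. -/
lemma commute_of_finite_maximizers {k : ℕ} {A B : Matrix (Fin n) (Fin n) ℂ} (hk1 : 1 ≤ k)
    (hk : k + 1 ≤ n) (hn1 : n ≤ 2 * k + 2) (hn2 : 2 * k ≤ n + 2) (hA : A.IsHermitian)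
    (hB : B.IsHermitian) {S : Set (Matrix (Fin n) (Fin n) ℂ)} (hS : S.Finite)
    (hcover : ∀ t, ∃ P ∈ S, IsMaxProj k P (rotate A B t)) : A * B = B * A := by
  set S' := {P ∈ S | P * A = A * P ∧ P * B = B * P} with hS'
  have hfin : S'.Finite := hS.subset (Set.sep_subset _ _)
  refine commute_of_cover hk1 hk hn1 hn2 hA hB hfin (fun P hP => hP.2.1) (fun P hP => hP.2.2) ?_
  set T := ⋃ P ∈ S', {t | IsMaxProj k P (rotate A B t)} with hT
  have hTcl : IsClosed T := hfin.isClosed_biUnion fun P _ => isClosed_isMaxProj_rotate k A B P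
  have hcount : Tᶜ.Countable := by
    have hsub : Tᶜ ⊆ ⋃ P ∈ S \ S', {t | IsMaxProj k P (rotate A B t)} := by
      intro t ht
      obtain ⟨P, hP, hPt⟩ := hcover t
      refine Set.mem_biUnion (show P ∈ S \ S' from ⟨hP, fun h => ht ?_⟩) hPt
      exact Set.mem_biUnion h hPt
    refine (Set.Countable.biUnion (hS.subset Set.sdiff_subset).countable ?_).mono hsub
    intro P hP
    rcases Set.eq_empty_or_nonempty {t | IsMaxProj k P (rotate A B t)} with h | ⟨s, hs⟩
    · rw [h]; exact Set.countable_empty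
    · refine (countable_setOf_sin_sub_eq_zero s).mono fun t ht => ?_
      by_contra hst
      have hrot := isHermitian_rotate hA hB
      exact hP.2 ⟨hP.1, commute_of_commute_rotate hst
        (IsMaxProj.commute hk1 (by omega) (hrot s) hs)
        (IsMaxProj.commute hk1 (by omega) (hrot t) ht)⟩
  have hdense : Dense T := by simpa using hcount.dense_compl ℝ
  have huniv : T = Set.univ := hTcl.closure_eq ▸ hdense.closure_eq
  intro t
  have : t ∈ T := huniv ▸ Set.mem_univ t
  simpa [hT] using this

lemma IsRankProj.trace_mul_im {k : ℕ} {P A : Matrix (Fin n) (Fin n) ℂ} (hP : IsRankProj k P)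
    (hA : A.IsHermitian) : (P * A).trace.im = 0 := by
  have h : star (P * A).trace = (P * A).trace := by
    rw [← trace_conjTranspose, conjTranspose_mul, hP.isHermitian.eq, hA.eq, trace_mul_comm]
  exact Complex.conj_eq_iff_im.1 h

open scoped ComplexStarModule in
lemma IsRankProj.trace_mul_parts {k : ℕ} {P : Matrix (Fin n) (Fin n) ℂ} (hP : IsRankProj k P)
    (X : Matrix (Fin n) (Fin n) ℂ) :
    (P * (ℜ X : Matrix (Fin n) (Fin n) ℂ)).trace.re = (P * X).trace.re ∧
      (P * (ℑ X : Matrix (Fin n) (Fin n) ℂ)).trace.re = (P * X).trace.im := by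
  have h1 := hP.trace_mul_im (A := (ℜ X : Matrix (Fin n) (Fin n) ℂ)) (ℜ X).2
  have h2 := hP.trace_mul_im (A := (ℑ X : Matrix (Fin n) (Fin n) ℂ)) (ℑ X).2
  have h3 : (P * X).trace = (P * (ℜ X : Matrix (Fin n) (Fin n) ℂ)).trace +
      Complex.I * (P * (ℑ X : Matrix (Fin n) (Fin n) ℂ)).trace := by
    conv_lhs => rw [← realPart_add_I_smul_imaginaryPart X]
    rw [mul_add, trace_add, mul_smul_comm, trace_smul, smul_eq_mul]
  rw [h3]
  simp [h1, h2]

lemma exists_finite_maximizers {m k : ℕ} (hk : k ≤ n) {A : Fin m → Matrix (Fin n) (Fin n) ℂ}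
    (h : IsPolyhedral (jointKNumRange k A)) :
    ∃ S : Set (Matrix (Fin n) (Fin n) ℂ), S.Finite ∧ ∀ f : (Fin m → ℂ) →ₗ[ℝ] ℝ,
      ∃ P ∈ S, IsRankProj k P ∧ ∀ Q, IsRankProj k Q →
        f (fun j => (Q * A j).trace) ≤ f (fun j => (P * A j).trace) := by
  obtain ⟨G, hG, hGeq⟩ := h
  rw [jointKNumRange_eq hk] at hGeq
  have hsub : ∀ g ∈ G, ∃ P, IsRankProj k P ∧ ∀ j, g j = (P * A j).trace := fun g hg => by
    have : g ∈ convexHull ℝ G := subset_convexHull ℝ G hg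
    rwa [← hGeq] at this
  choose! p hp hpg using hsub
  have hne : G.Nonempty := by
    rw [← convexHull_nonempty_iff (𝕜 := ℝ), ← hGeq]
    exact ⟨_, _, isRankProj_diagonal_lt hk, fun j => rfl⟩
  refine ⟨p '' G, hG.image p, fun f => ?_⟩
  obtain ⟨g, hg, hmax⟩ := hG.exists_maximalFor f G hne
  have hmax' : ∀ x ∈ G, f x ≤ f g := fun x hx => (le_total (f x) (f g)).elim id (hmax hx)
  refine ⟨p g, ⟨g, hg, rfl⟩, hp g hg, fun Q hQ => ?_⟩
  have hQm : (fun j => (Q * A j).trace) ∈ convexHull ℝ G := by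
    rw [← hGeq]; exact ⟨Q, hQ, fun j => rfl⟩
  have hle : convexHull ℝ G ⊆ {x | f x ≤ f g} :=
    convexHull_min hmax' (convex_halfSpace_le f.isLinear _)
  have hgp : g = fun j => (p g * A j).trace := funext (hpg g hg)
  rw [← hgp]
  exact hle hQm

lemma commute_of_isPolyhedral {m k : ℕ} (hk1 : 1 ≤ k)
    (hk : k + 1 ≤ n) (hn1 : n ≤ 2 * k + 2) (hn2 : 2 * k ≤ n + 2)
    {A : Fin m → Matrix (Fin n) (Fin n) ℂ} (h : IsPolyhedral (jointKNumRange k A))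
    {H K : Matrix (Fin n) (Fin n) ℂ} (hH : H.IsHermitian) (hK : K.IsHermitian)
    (f g : (Fin m → ℂ) →ₗ[ℝ] ℝ)
    (hf : ∀ P, IsRankProj k P → (P * H).trace.re = f fun j => (P * A j).trace)
    (hg : ∀ P, IsRankProj k P → (P * K).trace.re = g fun j => (P * A j).trace) :
    H * K = K * H := by
  obtain ⟨S, hS, hmax⟩ := exists_finite_maximizers (by omega) h
  refine commute_of_finite_maximizers hk1 hk hn1 hn2 hH hK hS fun t => ?_
  obtain ⟨P, hPS, hP, hP'⟩ := hmax (Real.cos t • f + Real.sin t • g)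
  refine ⟨P, hPS, hP, fun Q hQ => ?_⟩
  rw [trace_mul_rotate_re, trace_mul_rotate_re, hf P hP, hf Q hQ, hg P hP, hg Q hQ]
  simpa using hP' Q hQ

open scoped ComplexStarModule in
lemma normal_and_commute_of_isPolyhedral {k : ℕ} (hk1 : 1 ≤ k) (hk : k + 1 ≤ n)
    (hn1 : n ≤ 2 * k + 2) (hn2 : 2 * k ≤ n + 2) {X Y : Matrix (Fin n) (Fin n) ℂ}
    (h : IsPolyhedral (jointKNumRange k ![X, Y])) : X * Xᴴ = Xᴴ * X ∧ X * Y = Y * X := by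
  have key := fun {H K} => commute_of_isPolyhedral (H := H) (K := K) hk1 hk hn1 hn2 h
  let re (j : Fin 2) : (Fin 2 → ℂ) →ₗ[ℝ] ℝ := Complex.reLm ∘ₗ LinearMap.proj j
  let im (j : Fin 2) : (Fin 2 → ℂ) →ₗ[ℝ] ℝ := Complex.imLm ∘ₗ LinearMap.proj j
  have hXX : Commute (ℜ X : Matrix (Fin n) (Fin n) ℂ) (ℑ X) :=
    key (ℜ X).2 (ℑ X).2 (re 0) (im 0) (fun P hP => (hP.trace_mul_parts X).1)
      (fun P hP => (hP.trace_mul_parts X).2)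
  have hrr : Commute (ℜ X : Matrix (Fin n) (Fin n) ℂ) (ℜ Y) :=
    key (ℜ X).2 (ℜ Y).2 (re 0) (re 1) (fun P hP => (hP.trace_mul_parts X).1)
      (fun P hP => (hP.trace_mul_parts Y).1)
  have hri : Commute (ℜ X : Matrix (Fin n) (Fin n) ℂ) (ℑ Y) :=
    key (ℜ X).2 (ℑ Y).2 (re 0) (im 1) (fun P hP => (hP.trace_mul_parts X).1)
      (fun P hP => (hP.trace_mul_parts Y).2)
  have hir : Commute (ℑ X : Matrix (Fin n) (Fin n) ℂ) (ℜ Y) :=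
    key (ℑ X).2 (ℜ Y).2 (im 0) (re 1) (fun P hP => (hP.trace_mul_parts X).2)
      (fun P hP => (hP.trace_mul_parts Y).1)
  have hii : Commute (ℑ X : Matrix (Fin n) (Fin n) ℂ) (ℑ Y) :=
    key (ℑ X).2 (ℑ Y).2 (im 0) (im 1) (fun P hP => (hP.trace_mul_parts X).2)
      (fun P hP => (hP.trace_mul_parts Y).2)
  constructor
  · have := isStarNormal_iff_commute_realPart_imaginaryPart.2 hXX
    exact this.star_comm_self.eq.symm
  · have : Commute X Y := by
      rw [← realPart_add_I_smul_imaginaryPart X, ← realPart_add_I_smul_imaginaryPart Y]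
      exact ((hrr.add_right (hri.smul_right _)).add_left
        ((hir.add_right (hii.smul_right _)).smul_left _))
    exact this.eq

lemma exists_unitary_simultaneous {ι : Type*} {T : ι → Matrix (Fin n) (Fin n) ℂ}
    (hT : ∀ j, (T j).IsHermitian) (hC : ∀ i j, Commute (T i) (T j)) :
    ∃ V ∈ unitaryGroup (Fin n) ℂ, ∀ j, ∃ d, T j * V = V * diagonal d := by
  classical
  let L (j : ι) : EuclideanSpace ℂ (Fin n) →ₗ[ℂ] EuclideanSpace ℂ (Fin n) := (T j).toEuclideanLin
  have hL : ∀ j, (L j).IsSymmetric := fun j => isSymmetric_toEuclideanLin_iff.2 (hT j)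
  have hLC : Pairwise (Function.onFun Commute L) := fun i j _ => by
    ext v
    simp [L, mulVec_mulVec, (hC i j).eq]
  let E (χ : ι → ℂ) := ⨅ j, Module.End.eigenspace (L j) (χ j)
  have hdec : DirectSum.IsInternal E :=
    LinearMap.IsSymmetric.directSum_isInternal_of_pairwise_commute hL hLC
  have horth := LinearMap.IsSymmetric.orthogonalFamily_iInf_eigenspaces hL
  have hfin : Finite {χ // E χ ≠ ⊥} :=
    WellFoundedGT.finite_ne_bot_of_iSupIndep hdec.submodule_iSupIndep
  have := Fintype.ofFinite {χ // E χ ≠ ⊥}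
  have hdec' := DirectSum.isInternal_ne_bot_iff.2 hdec
  have horth' := horth.comp (γ := {χ // E χ ≠ ⊥}) Subtype.val_injective
  have hdim : Module.finrank ℂ (EuclideanSpace ℂ (Fin n)) = n := by simp
  let b := hdec'.subordinateOrthonormalBasis hdim horth'
  let χ (i : Fin n) : ι → ℂ := (hdec'.subordinateOrthonormalBasisIndex hdim i horth').1
  have hb : ∀ i j, T j *ᵥ (b i).ofLp = χ i j • (b i).ofLp := fun i j => by
    have h : b i ∈ E (χ i) := hdec'.subordinateOrthonormalBasis_subordinate hdim i horth'
    have h2 := Module.End.mem_eigenspace_iff.1 ((Submodule.mem_iInf _).1 h j)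
    simpa [L] using congrArg WithLp.ofLp h2
  refine ⟨(EuclideanSpace.basisFun (Fin n) ℂ).toBasis.toMatrix b,
    OrthonormalBasis.toMatrix_orthonormalBasis_mem_unitary _ _, fun j => ⟨fun i => χ i j, ?_⟩⟩
  ext r i
  rw [mul_diagonal]
  simpa [mul_apply, mulVec, dotProduct, Module.Basis.toMatrix_apply, mul_comm] using
    congrFun (hb i j) r

open scoped ComplexStarModule Matrix.Norms.L2Operator in
lemma exists_unitary_of_commute {X Y : Matrix (Fin n) (Fin n) ℂ} (hX : X * Xᴴ = Xᴴ * X)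
    (hY : Y * Yᴴ = Yᴴ * Y) (hXY : X * Y = Y * X) :
    ∃ V ∈ unitaryGroup (Fin n) ℂ, ∃ x y, X * V = V * diagonal x ∧ Y * V = V * diagonal y := by
  have nX : IsStarNormal X := ⟨hX.symm⟩
  have nY : IsStarNormal Y := ⟨hY.symm⟩
  have c1 : Commute X Y := hXY
  have c2 : Commute X (star Y) := nY.commute_star_right c1
  have c3 : Commute (star X) Y := nX.commute_star_left c1
  have c4 : Commute (star X) (star Y) := nX.commute_star_left c2
  have hparts : ∀ {A B : Matrix (Fin n) (Fin n) ℂ}, Commute A B → Commute A (star B) →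
      Commute A (ℜ B : Matrix (Fin n) (Fin n) ℂ) ∧ Commute A (ℑ B : Matrix (Fin n) (Fin n) ℂ) := by
    intro A B h1 h2
    constructor
    · rw [realPart_apply_coe]
      exact (h1.add_right h2).smul_right _
    · rw [imaginaryPart_apply_coe]
      exact ((h1.sub_right h2).smul_right _).smul_right _
  let T : Fin 4 → Matrix (Fin n) (Fin n) ℂ := ![ℜ X, ℑ X, ℜ Y, ℑ Y]
  have hT : ∀ j, (T j).IsHermitian := by
    intro j
    fin_cases j
    · exact (ℜ X).2
    · exact (ℑ X).2
    · exact (ℜ Y).2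
    · exact (ℑ Y).2
  have d1 := hparts c1 c2
  have d2 := hparts c3 c4
  have e1 := hparts d1.1.symm d2.1.symm
  have e2 := hparts d1.2.symm d2.2.symm
  have fX : Commute (ℜ X : Matrix (Fin n) (Fin n) ℂ) (ℑ X) := Commute.realPart_imaginaryPart X
  have fY : Commute (ℜ Y : Matrix (Fin n) (Fin n) ℂ) (ℑ Y) := Commute.realPart_imaginaryPart Y
  have hC : ∀ i j, Commute (T i) (T j) := by
    intro i j
    fin_cases i <;> fin_cases j
    exacts [Commute.refl _, fX, e1.1.symm, e2.1.symm, fX.symm, Commute.refl _, e1.2.symm,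
      e2.2.symm, e1.1, e1.2, Commute.refl _, fY, e2.1, e2.2, fY.symm, Commute.refl _]
  obtain ⟨V, hV, h⟩ := exists_unitary_simultaneous hT hC
  have key : ∀ {A B C : Matrix (Fin n) (Fin n) ℂ}, C = A + Complex.I • B →
      (∃ d, A * V = V * diagonal d) → (∃ d, B * V = V * diagonal d) →
      ∃ d, C * V = V * diagonal d := by
    rintro A B C rfl ⟨d, hd⟩ ⟨d', hd'⟩
    refine ⟨d + Complex.I • d', ?_⟩
    rw [add_mul, smul_mul_assoc, hd, hd', ← mul_smul_comm, ← mul_add, ← diagonal_smul,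
      diagonal_add]
    rfl
  obtain ⟨x, hx⟩ := key (realPart_add_I_smul_imaginaryPart X).symm (h 0) (h 1)
  obtain ⟨y, hy⟩ := key (realPart_add_I_smul_imaginaryPart Y).symm (h 2) (h 3)
  exact ⟨V, hV, x, y, hx, hy⟩

lemma diagonal_mem_Icc {P : Matrix (Fin n) (Fin n) ℂ} (hP : P.IsHermitian) (hid : P * P = P)
    (i : Fin n) : (P i i).re ∈ Set.Icc (0 : ℝ) 1 := by
  have key : ∀ Q : Matrix (Fin n) (Fin n) ℂ, Q.IsHermitian → Q * Q = Q → 0 ≤ (Q i i).re := by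
    intro Q hQ hQid
    have h : Q.PosSemidef := by
      have := posSemidef_conjTranspose_mul_self Q
      rwa [hQ.eq, hQid] at this
    exact (Complex.nonneg_iff.1 (h.diag_nonneg (i := i))).1
  refine ⟨key P hP hid, ?_⟩
  have h := key (1 - P) (isHermitian_one.sub hP) (by noncomm_ring; rw [hid]; abel)
  simpa using h

/-- Conjugation by a plane rotation averages two diagonal entries of a matrix. -/
lemma exists_unitary_diagonal_average {P : Matrix (Fin n) (Fin n) ℂ} (hP : P.IsHermitian)
    {i j : Fin n} (hij : i ≠ j) {c s : ℝ} (hcs : c ^ 2 + s ^ 2 = 1) :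
    ∃ U ∈ unitaryGroup (Fin n) ℂ,
      (U * P * star U) i i = c ^ 2 * P i i + s ^ 2 * P j j ∧
      (U * P * star U) j j = s ^ 2 * P i i + c ^ 2 * P j j ∧
      ∀ r, r ≠ i → r ≠ j → (U * P * star U) r r = P r r := by
  obtain ⟨w, hw, hwP⟩ : ∃ w : ℂ, w * star w = 1 ∧ star w * P i j + w * P j i = 0 := by
    have hji : P j i = star (P i j) := (hP.apply j i).symm
    by_cases h0 : P i j = 0
    · exact ⟨1, by simp, by simp [hji, h0]⟩
    · have hn : (‖P i j‖ : ℂ) ≠ 0 := by simpa using h0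
      have hz : P i j * star (P i j) = (‖P i j‖ : ℂ) ^ 2 := by
        simpa using Complex.mul_conj' (P i j)
      refine ⟨Complex.I * (P i j / ‖P i j‖), ?_, ?_⟩
      · simp only [star_mul', star_div₀, RCLike.star_def, Complex.conj_I,
          Complex.conj_ofReal] at hz ⊢
        field_simp
        linear_combination -hz * Complex.I ^ 2 + (-(‖P i j‖ : ℂ) ^ 2) * Complex.I_sq
      · rw [hji]
        simp only [star_mul', star_div₀, RCLike.star_def, Complex.conj_I, Complex.conj_ofReal]
        ring
  let u (r : Fin n) : Fin n → ℂ :=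
    if r = i then Pi.single i (c : ℂ) + Pi.single j (s * w)
    else if r = j then Pi.single i (-(s * star w)) + Pi.single j (c : ℂ)
    else Pi.single r 1
  have hui : u i = Pi.single i (c : ℂ) + Pi.single j (s * w) := by simp [u]
  have huj : u j = Pi.single i (-(s * star w)) + Pi.single j (c : ℂ) := by simp [u, hij.symm]
  have hur : ∀ r, r ≠ i → r ≠ j → u r = Pi.single r 1 := fun r h1 h2 => by simp [u, h1, h2]
  have hent : ∀ M r t, (of u * M * star (of u)) r t = u r ⬝ᵥ (M *ᵥ star (u t)) := by
    intro M r t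
    rw [mul_assoc, mul_apply']
    rfl
  rw [RCLike.star_def] at hw hwP
  have hcs' : (c : ℂ) ^ 2 + (s : ℂ) ^ 2 = 1 := by exact_mod_cast hcs
  refine ⟨of u, ?_, ?_, ?_, ?_⟩
  · rw [mem_unitaryGroup_iff]
    ext r t
    have := hent 1 r t
    rw [mul_one, one_mulVec] at this
    rw [this]
    by_cases hri : r = i
    · subst hri
      by_cases hti : t = r
      · subst hti
        simp [hui, Pi.star_single, hij, hij.symm]
        linear_combination hcs' + (s : ℂ) ^ 2 * hw
      by_cases htj : t = j
      · subst htj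
        simp [hui, huj, Pi.star_single, hij, hij.symm]
        ring
      · simp [hui, hur t hti htj, Pi.star_single, Ne.symm hti, Ne.symm htj]
    by_cases hrj : r = j
    · subst hrj
      by_cases hti : t = i
      · subst hti
        simp [hui, huj, Pi.star_single, hij, hij.symm]
        ring
      by_cases htj : t = r
      · subst htj
        simp [huj, Pi.star_single, hij, hij.symm]
        linear_combination hcs' + (s : ℂ) ^ 2 * hw
      · simp [huj, hur t hti htj, Pi.star_single, Ne.symm hti, Ne.symm htj]
    · by_cases hti : t = i
      · subst hti
        simp [hui, hur r hri hrj, Pi.star_single, hri, hrj]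
      by_cases htj : t = j
      · subst htj
        simp [huj, hur r hri hrj, Pi.star_single, hri, hrj]
      · simp [hur r hri hrj, hur t hti htj, Pi.star_single, Pi.single_apply, one_apply, eq_comm]
  · rw [hent, hui]
    simp [mulVec_add, Pi.star_single]
    linear_combination (c : ℂ) * s * hwP + (s : ℂ) ^ 2 * P j j * hw
  · rw [hent, huj]
    simp [mulVec_add, Pi.star_single]
    linear_combination -(c : ℂ) * s * hwP + (s : ℂ) ^ 2 * P i i * hw
  · intro r h1 h2
    rw [hent, hur r h1 h2]
    simp [Pi.star_single]

/-- The hypersimplex of vectors in the unit cube with coordinate sum `k`. -/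
def hypersimplex (n k : ℕ) : Set (Fin n → ℝ) :=
  {d | (∀ i, d i ∈ Set.Icc (0 : ℝ) 1) ∧ ∑ i, d i = k}

/-- The vertices of the hypersimplex: the indicators of the `k`-element sets. -/
def hypersimplexVertices (n k : ℕ) : Set (Fin n → ℝ) :=
  (fun (s : Finset (Fin n)) i => if i ∈ s then (1 : ℝ) else 0) '' {s | s.card = k}

lemma exists_fractional_ne {k : ℕ} {d : Fin n → ℝ} (hd : d ∈ hypersimplex n k) {i : Fin n}
    (hi : d i ∈ Set.Ioo (0 : ℝ) 1) : ∃ j, j ≠ i ∧ d j ∈ Set.Ioo (0 : ℝ) 1 := by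
  by_contra! hcon
  have hdec : ∀ j ∈ Finset.univ.erase i, d j = ((if d j = 1 then 1 else 0 : ℤ) : ℝ) := by
    intro j hj
    have h1 := hcon j (Finset.ne_of_mem_erase hj)
    obtain ⟨h2, h3⟩ := hd.1 j
    split_ifs with h
    · simpa using h
    · have h4 : d j < 1 := lt_of_le_of_ne h3 h
      have : ¬ 0 < d j := fun h5 => h1 ⟨h5, h4⟩
      simp only [Int.cast_zero]
      linarith
  have hsum := hd.2
  rw [← Finset.add_sum_erase _ _ (Finset.mem_univ i), Finset.sum_congr rfl hdec,
    ← Int.cast_sum] at hsum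
  set z : ℤ := ∑ j ∈ Finset.univ.erase i, if d j = 1 then 1 else 0
  have hz : d i = ((k - z : ℤ) : ℝ) := by push_cast; linarith
  rw [hz] at hi
  have h1 : (0 : ℤ) < k - z := by exact_mod_cast hi.1
  have h2 : (k - z : ℤ) < 1 := by exact_mod_cast hi.2
  omega

/-- Moving mass `t` from coordinate `j` to coordinate `i`. -/
def transfer (d : Fin n → ℝ) (i j : Fin n) (t : ℝ) : Fin n → ℝ :=
  d + t • (Pi.single i 1 - Pi.single j 1)

lemma transfer_left (d : Fin n → ℝ) {i j : Fin n} (hij : i ≠ j) (t : ℝ) :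
    transfer d i j t i = d i + t := by
  simp [transfer, hij]

lemma transfer_right (d : Fin n → ℝ) {i j : Fin n} (hij : i ≠ j) (t : ℝ) :
    transfer d i j t j = d j - t := by
  simp [transfer, hij.symm, sub_eq_add_neg]

lemma transfer_of_ne (d : Fin n → ℝ) {i j r : Fin n} (hi : r ≠ i) (hj : r ≠ j) (t : ℝ) :
    transfer d i j t r = d r := by
  simp [transfer, hi, hj]

lemma transfer_mem_hypersimplex {k : ℕ} {d : Fin n → ℝ} (hd : d ∈ hypersimplex n k)
    {i j : Fin n} (hij : i ≠ j) {t : ℝ} (hi : d i + t ∈ Set.Icc (0 : ℝ) 1)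
    (hj : d j - t ∈ Set.Icc (0 : ℝ) 1) : transfer d i j t ∈ hypersimplex n k := by
  constructor
  · intro r
    by_cases hri : r = i
    · rwa [hri, transfer_left d hij]
    by_cases hrj : r = j
    · rwa [hrj, transfer_right d hij]
    · rw [transfer_of_ne d hri hrj]; exact hd.1 r
  · have := hd.2
    simp [transfer, Finset.sum_add_distrib, ← Finset.mul_sum, this]

open Classical in
lemma card_fractional_transfer_lt {d : Fin n → ℝ} {i j : Fin n} (hij : i ≠ j) {t : ℝ}
    (hi : d i ∈ Set.Ioo (0 : ℝ) 1) (hj : d j ∈ Set.Ioo (0 : ℝ) 1)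
    (h : d i + t ∉ Set.Ioo (0 : ℝ) 1 ∨ d j - t ∉ Set.Ioo (0 : ℝ) 1) :
    (Finset.univ.filter fun r => transfer d i j t r ∈ Set.Ioo (0 : ℝ) 1).card <
      (Finset.univ.filter fun r => d r ∈ Set.Ioo (0 : ℝ) 1).card := by
  apply Finset.card_lt_card
  rw [Finset.ssubset_iff_of_subset]
  · rcases h with h | h
    · exact ⟨i, by simpa using hi, by simpa [transfer_left d hij] using h⟩
    · exact ⟨j, by simpa using hj, by simpa [transfer_right d hij] using h⟩
  · intro r hr
    by_cases hri : r = i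
    · simpa [hri] using hi
    by_cases hrj : r = j
    · simpa [hrj] using hj
    · simpa [transfer_of_ne d hri hrj] using hr

lemma hypersimplex_induction {k : ℕ} {Q : (Fin n → ℝ) → Prop}
    (hv : ∀ d ∈ hypersimplexVertices n k, Q d)
    (hs : ∀ d i j s t, i ≠ j → 0 < s → 0 < t → Q (transfer d i j t) → Q (transfer d j i s) → Q d)
    {d : Fin n → ℝ} (hd : d ∈ hypersimplex n k) : Q d := by
  classical
  induction hN : (Finset.univ.filter fun r => d r ∈ Set.Ioo (0 : ℝ) 1).card using
    Nat.strong_induction_on generalizing d with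
  | _ N ih =>
  by_cases hfrac : ∃ i, d i ∈ Set.Ioo (0 : ℝ) 1
  · obtain ⟨i, hi⟩ := hfrac
    obtain ⟨j, hji, hj⟩ := exists_fractional_ne hd hi
    have step : ∀ i j, i ≠ j → d i ∈ Set.Ioo (0 : ℝ) 1 → d j ∈ Set.Ioo (0 : ℝ) 1 →
        0 < min (1 - d i) (d j) ∧ Q (transfer d i j (min (1 - d i) (d j))) := by
      intro i j hij hi hj
      have hpos : 0 < min (1 - d i) (d j) := lt_min (by linarith [hi.2]) hj.1
      have h1 := min_le_left (1 - d i) (d j)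
      have h2 := min_le_right (1 - d i) (d j)
      refine ⟨hpos, ih _ (hN ▸ card_fractional_transfer_lt hij hi hj ?_)
        (transfer_mem_hypersimplex hd hij ⟨by linarith [hi.1], by linarith⟩
          ⟨by linarith, by linarith [hj.2]⟩) rfl⟩
      rcases min_choice (1 - d i) (d j) with h | h <;> rw [h] <;> simp
    obtain ⟨h1, h2⟩ := step i j hji.symm hi hj
    obtain ⟨h3, h4⟩ := step j i hji hj hi
    exact hs d i j _ _ hji.symm h3 h1 h2 h4
  · push Not at hfrac
    have h01 : ∀ i, d i = if d i = 1 then 1 else 0 := by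
      intro i
      obtain ⟨h2, h3⟩ := hd.1 i
      split_ifs with h
      · exact h
      · have : ¬ 0 < d i := fun h5 => hfrac i ⟨h5, lt_of_le_of_ne h3 h⟩
        linarith
    refine hv d ⟨Finset.univ.filter fun i => d i = 1, ?_, ?_⟩
    · have := hd.2
      rw [Finset.sum_congr rfl fun i _ => h01 i, Finset.sum_boole] at this
      exact_mod_cast this
    · ext i
      simpa using (h01 i).symm

lemma hypersimplex_subset_convexHull (k : ℕ) :
    hypersimplex n k ⊆ convexHull ℝ (hypersimplexVertices n k) := by
  intro d hd
  refine hypersimplex_induction (Q := (· ∈ convexHull ℝ (hypersimplexVertices n k)))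
    (fun d hd => subset_convexHull ℝ _ hd) ?_ hd
  intro d i j s t hij hs ht h1 h2
  have hst : 0 < s + t := by linarith
  have hd : d = (s / (s + t)) • transfer d i j t + (t / (s + t)) • transfer d j i s := by
    ext r
    simp only [transfer, Pi.add_apply, Pi.smul_apply, smul_eq_mul, Pi.sub_apply]
    field_simp
    ring
  rw [hd]
  exact convex_convexHull ℝ _ h1 h2 (by positivity) (by positivity) (by field_simp)

/-- Schur–Horn for projections. -/
lemma exists_isRankProj_diagonal {k : ℕ} {d : Fin n → ℝ} (hd : d ∈ hypersimplex n k) :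
    ∃ P, IsRankProj k P ∧ ∀ i, P i i = (d i : ℂ) := by
  refine hypersimplex_induction (Q := fun d => ∃ P, IsRankProj k P ∧ ∀ i, P i i = (d i : ℂ))
    ?_ ?_ hd
  · rintro _ ⟨s, hs, rfl⟩
    refine ⟨_, hs ▸ IsRankProj.diagonal_indicator s, fun i => ?_⟩
    by_cases h : i ∈ s <;> simp [h]
  · have key : ∀ (d : Fin n → ℝ) i j t, i ≠ j → 0 < t → d j ≤ d i →
        (∃ P, IsRankProj k P ∧ ∀ r, P r r = (transfer d i j t r : ℂ)) →
        ∃ P, IsRankProj k P ∧ ∀ i, P i i = (d i : ℂ) := by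
      rintro d i j t hij ht hle ⟨P, hP, hdiag⟩
      have hden : 0 < d i - d j + 2 * t := by linarith
      set a := (d i - d j + t) / (d i - d j + 2 * t) with ha
      set b := t / (d i - d j + 2 * t) with hb
      have ha0 : 0 ≤ a := by rw [ha]; apply div_nonneg <;> linarith
      have hb0 : 0 ≤ b := by positivity
      have hab : a + b = 1 := by
        rw [ha, hb, ← add_div, div_eq_one_iff_eq hden.ne']; ring
      have ha' : a * (d i - d j + 2 * t) = d i - d j + t :=
        div_mul_cancel₀ _ hden.ne'
      obtain ⟨U, hU, h1, h2, h3⟩ := exists_unitary_diagonal_average hP.isHermitian hij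
        (c := √a) (s := √b) (by rw [Real.sq_sqrt ha0, Real.sq_sqrt hb0, hab])
      refine ⟨_, hP.conj hU, fun r => ?_⟩
      have hac : ((√a : ℝ) : ℂ) ^ 2 = a := by exact_mod_cast Real.sq_sqrt ha0
      have hbc : ((√b : ℝ) : ℂ) ^ 2 = b := by exact_mod_cast Real.sq_sqrt hb0
      have hba : b = 1 - a := by linarith
      by_cases hri : r = i
      · rw [hri, h1, hdiag, hdiag, transfer_left d hij, transfer_right d hij, hac, hbc, hba]
        norm_cast
        linarith
      by_cases hrj : r = j
      · rw [hrj, h2, hdiag, hdiag, transfer_left d hij, transfer_right d hij, hac, hbc, hba]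
        norm_cast
        linarith
      · rw [h3 r hri hrj, hdiag, transfer_of_ne d hri hrj]
    intro d i j s t hij hs ht h1 h2
    rcases le_total (d j) (d i) with h | h
    · exact key d i j t hij ht h h1
    · exact key d j i s hij.symm hs h h2

lemma isPolyhedral_of_diagonalized {m k : ℕ} (hk : k ≤ n) {A : Fin m → Matrix (Fin n) (Fin n) ℂ}
    {V : Matrix (Fin n) (Fin n) ℂ} (hV : V ∈ unitaryGroup (Fin n) ℂ) {a : Fin m → Fin n → ℂ}
    (hA : ∀ j, A j * V = V * diagonal (a j)) : IsPolyhedral (jointKNumRange k A) := by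
  let L : (Fin n → ℝ) →ₗ[ℝ] (Fin m → ℂ) :=
    LinearMap.pi fun j => ∑ i, (LinearMap.proj i).smulRight (a j i)
  have hL : ∀ d j, L d j = ∑ i, (d i : ℂ) * a j i := fun d j => by simp [L]
  have hfin : (hypersimplexVertices n k).Finite := (Set.toFinite _).image _
  refine ⟨L '' hypersimplexVertices n k, hfin.image L, ?_⟩
  rw [← LinearMap.image_convexHull, jointKNumRange_eq hk]
  have hVV : V * star V = 1 := mem_unitaryGroup_iff.1 hV
  have htr : ∀ Q d, (∀ i, Q i i = (d i : ℂ)) → ∀ j,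
      (V * Q * star V * A j).trace = L d j := by
    intro Q d hQ j
    have hAj : A j = V * diagonal (a j) * star V := by rw [← hA, mul_assoc, hVV, mul_one]
    have : V * Q * star V * A j = V * (Q * diagonal (a j)) * star V := by
      rw [hAj]
      calc _ = V * Q * (star V * V) * diagonal (a j) * star V := by simp only [mul_assoc]
        _ = _ := by rw [mem_unitaryGroup_iff'.1 hV]; simp only [mul_assoc, one_mul]
    rw [this, trace_mul_comm, ← mul_assoc, mem_unitaryGroup_iff'.1 hV, one_mul, hL, trace]
    simp [hQ]
  have hVs : star V ∈ unitaryGroup (Fin n) ℂ := Unitary.star_mem hV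
  ext p
  constructor
  · rintro ⟨P, hP, hp⟩
    have hQ := hP.conj hVs
    set Q := star V * P * star (star V) with hQdef
    refine ⟨fun i => (Q i i).re, hypersimplex_subset_convexHull k ⟨fun i =>
      diagonal_mem_Icc hQ.isHermitian hQ.mul_self i, ?_⟩, ?_⟩
    · have := congrArg Complex.re hQ.trace_eq
      simpa [trace] using this
    · have hre : ∀ i, Q i i = ((Q i i).re : ℂ) := fun i =>
        (hQ.isHermitian.coe_re_apply_self i).symm
      ext j
      rw [← htr Q _ hre, hp j, hQdef]
      congr 2
      calc V * (star V * P * star (star V)) * star V = (V * star V) * P * (V * star V) := by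
            simp only [mul_assoc, star_star]
        _ = P := by rw [hVV]; simp
  · rintro ⟨d, hd, rfl⟩
    have hd' : d ∈ hypersimplex n k := by
      refine convexHull_min ?_ ?_ hd
      · rintro _ ⟨s, hs, rfl⟩
        refine ⟨fun i => ?_, ?_⟩
        · by_cases h : i ∈ s <;> simp [h]
        · simpa using hs
      · intro x hx y hy α β hα hβ hαβ
        refine ⟨fun i => convex_Icc 0 1 (hx.1 i) (hy.1 i) hα hβ hαβ, ?_⟩
        simp only [Pi.add_apply, Pi.smul_apply, smul_eq_mul, Finset.sum_add_distrib,
          ← Finset.mul_sum, hx.2, hy.2]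
        rw [← add_mul, hαβ, one_mul]
    obtain ⟨Q, hQ, hQd⟩ := exists_isRankProj_diagonal hd'
    exact ⟨_, hQ.conj hV, fun j => (htr Q d hQd j).symm⟩

end

theorem stmt_7 {n : ℕ} (hn : 2 ≤ n)
    (F : Set (Matrix (Fin n) (Fin n) ℂ)) (hF : F.Nonempty) :
    ((∀ X ∈ F, X * Xᴴ = Xᴴ * X) ∧ (∀ X ∈ F, ∀ Y ∈ F, X * Y = Y * X)) ↔
      (∃ k : ℕ, 1 ≤ k ∧ k ≤ n - 1 ∧
        (n : ℝ) / 2 - 1 ≤ (k : ℝ) ∧ (k : ℝ) ≤ (n : ℝ) / 2 + 1 ∧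
        ∀ X ∈ F, ∀ Y ∈ F, IsPolyhedral (jointKNumRange k ![X, Y])) := by
  constructor
  · rintro ⟨hnormal, hcomm⟩
    have h1 : (n : ℝ) ≤ 2 * ((n / 2 : ℕ) : ℝ) + 1 := by
      have : n ≤ 2 * (n / 2) + 1 := by omega
      exact_mod_cast this
    have h2 : 2 * ((n / 2 : ℕ) : ℝ) ≤ n := by
      have : 2 * (n / 2) ≤ n := by omega
      exact_mod_cast this
    refine ⟨n / 2, by omega, by omega, by linarith, by linarith, fun X hX Y hY => ?_⟩
    obtain ⟨V, hV, x, y, hx, hy⟩ :=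
      exists_unitary_of_commute (hnormal X hX) (hnormal Y hY) (hcomm X hX Y hY)
    refine isPolyhedral_of_diagonalized (by omega) hV (a := ![x, y]) fun j => ?_
    fin_cases j
    · exact hx
    · exact hy
  · rintro ⟨k, hk1, hkn, hl, hu, hpoly⟩
    have hn1 : n ≤ 2 * k + 2 := by
      have : (n : ℝ) ≤ 2 * k + 2 := by linarith
      exact_mod_cast this
    have hn2 : 2 * k ≤ n + 2 := by
      have : 2 * (k : ℝ) ≤ n + 2 := by linarith
      exact_mod_cast this
    have key := fun X hX Y hY =>
      normal_and_commute_of_isPolyhedral hk1 (by omega) hn1 hn2 (hpoly X hX Y hY)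
    exact ⟨fun X hX => (key X hX X hX).1, fun X hX Y hY => (key X hX Y hY).2⟩
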